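/- Let l ≥ 1 and let L₀ be the total divergence of smooth functions F^λ of jet variables of order ≤ l−1. Then every smooth φ : ℝ^n → ℝ satisfies identically the Euler–Lagrange equation of order 2l of L₀: Σ_{m=0}^{l} (−1)^m Σ_{μ₁,…,μ_m} ∂_{μ₁}⋯∂_{μ_m} [ (∂L₀/∂u_{μ₁…μ_m}) evaluated along the l-jet of φ ] = 0. In other words, the higher-order Euler–Lagrange operator annihilates total divergences: the dynamics generated by a total-divergence Lagrangian is trivial. -/

import Mathlib

noncomputable section

open scoped BigOperators

/-- Points of the base `ℝⁿ`. -/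
abbrev Vec (n : ℕ) : Type := Fin n → ℝ

/-- The space of jet variables `(u_{μ₁…μ_r})_{0 ≤ r ≤ k}` of order `≤ k`
(arrays indexed by tuples of indices). -/
abbrev JetU (n k : ℕ) : Type := ∀ r : Fin (k + 1), (Fin (r : ℕ) → Fin n) → ℝ

/-- The full variable space `(x^μ; u_{μ₁…μ_r}, 0 ≤ r ≤ k)` of a `k`-th order
Lagrangian. -/
abbrev Jet (n k : ℕ) : Type := Vec n × JetU n k

/-- Iterated partial derivative `∂_{t 0} ⋯ ∂_{t (l-1)} g` at `x`. -/
def pderivIter (n l : ℕ) (t : Fin l → Fin n) (g : Vec n → ℝ) (x : Vec n) : ℝ :=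
  iteratedFDeriv ℝ l g x fun i => Pi.single (t i) 1

/-- Partial derivative `∂_λ g` at `x`. -/
def pderiv1 (n : ℕ) (lam : Fin n) (g : Vec n → ℝ) (x : Vec n) : ℝ :=
  fderiv ℝ g x (Pi.single lam 1)

/-- The `k`-jet of `φ` at `x`: substitute `u_{μ₁…μ_r} = ∂_{μ₁}⋯∂_{μ_r} φ(x)`. -/
def jetEv (n k : ℕ) (φ : Vec n → ℝ) (x : Vec n) : Jet n k :=
  (x, fun r t => pderivIter n (r : ℕ) t φ x)

/-- The symmetric array `∂L/∂u_{μ₁…μ_r}` (the array characterized by the fact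
that its full contraction with a symmetric increment of the rank-`r` jet
variables is the corresponding directional derivative of `L`), evaluated at the
tuple `t` and the point `z`. -/
def dLdu (n k : ℕ) (L : Jet n k → ℝ) (r : Fin (k + 1)) (t : Fin (r : ℕ) → Fin n)
    (z : Jet n k) : ℝ :=
  ((r : ℕ).factorial : ℝ)⁻¹ *
    ∑ σ : Equiv.Perm (Fin (r : ℕ)),
      fderiv ℝ L z (0, Pi.single r (Pi.single (t ∘ σ) 1))

/-- Total symmetrization `q^{(μ₁…μ_l λ)}` of a momentum array
`q^{μ₁…μ_l λ}`, evaluated at the length-`(l+1)` tuple `s`. -/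
def symComb (n l : ℕ) (q : (Fin l → Fin n) → Fin n → ℝ) (s : Fin (l + 1) → Fin n) : ℝ :=
  ((l + 1).factorial : ℝ)⁻¹ *
    ∑ σ : Equiv.Perm (Fin (l + 1)),
      q (fun i => s (σ (Fin.castSucc i))) (s (σ (Fin.last l)))

/-- Momenta `p^{μ₁…μ_l λ}` (`0 ≤ l ≤ k−1`) for a `k`-th order theory:
fields on `ℝⁿ` indexed by a tuple `μ₁…μ_l` and an extra index `λ`. -/
abbrev Mom (n k : ℕ) : Type := ∀ l : Fin k, (Fin (l : ℕ) → Fin n) → Fin n → Vec n → ℝ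

/-- `C^∞` smoothness. -/
def IsCInf {E F : Type*} [NormedAddCommGroup E] [NormedSpace ℝ E]
    [NormedAddCommGroup F] [NormedSpace ℝ F] (f : E → F) : Prop :=
  ∀ m : ℕ, ContDiff ℝ m f

/-- All components of the momenta are smooth. -/
def MomSmooth (n k : ℕ) (p : Mom n k) : Prop :=
  ∀ (l : Fin k) (t : Fin (l : ℕ) → Fin n) (lam : Fin n), IsCInf (p l t lam)

/-- The momenta are symmetric in the indices `μ₁…μ_l`. -/
def MomSym (n k : ℕ) (p : Mom n k) : Prop :=
  ∀ (l : Fin k) (σ : Equiv.Perm (Fin (l : ℕ))) (t : Fin (l : ℕ) → Fin n)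
    (lam : Fin n) (x : Vec n), p l (t ∘ σ) lam x = p l t lam x

/-- The momenta are totally symmetric in all indices `μ₁…μ_l λ`. -/
def MomTotSym (n k : ℕ) (p : Mom n k) : Prop :=
  ∀ (l : Fin k) (σ : Equiv.Perm (Fin ((l : ℕ) + 1))) (s : Fin ((l : ℕ) + 1) → Fin n)
    (x : Vec n),
    p l (fun i => s (σ (Fin.castSucc i))) (s (σ (Fin.last (l : ℕ)))) x
      = p l (fun i => s (Fin.castSucc i)) (s (Fin.last (l : ℕ))) x

/-- The canonical first-order Euler–Lagrange system of a `(K+1)`-th order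
Lagrangian `L` for a pair `(φ, p)`:
`p^{(μ₁…μ_k)} = ∂L/∂u_{μ₁…μ_k}`;
`p^{(μ₁…μ_l)} = ∂L/∂u_{μ₁…μ_l} − Σ_λ ∂_λ p^{μ₁…μ_l λ}` for `1 ≤ l ≤ k−1`;
`0 = ∂L/∂u − Σ_λ ∂_λ p^λ`, all derivatives of `L` being evaluated along the
`k`-jet of `φ` (here `k = K+1`). -/
def CanonSys (n K : ℕ) (L : Jet n (K + 1) → ℝ) (φ : Vec n → ℝ) (p : Mom n (K + 1)) : Prop :=
  (∀ x : Vec n,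
      dLdu n (K + 1) L ⟨0, Nat.succ_pos _⟩ Fin.elim0 (jetEv n (K + 1) φ x)
        - ∑ lam : Fin n, pderiv1 n lam (p ⟨0, Nat.succ_pos _⟩ Fin.elim0 lam) x = 0)
  ∧ (∀ (l : Fin (K + 1)) (s : Fin ((l : ℕ) + 1) → Fin n) (x : Vec n),
      symComb n (l : ℕ) (fun t lam => p l t lam x) s
        = dLdu n (K + 1) L ⟨(l : ℕ) + 1, Nat.succ_lt_succ l.isLt⟩ s (jetEv n (K + 1) φ x)
          - if h : (l : ℕ) + 1 < K + 1 then
              ∑ lam : Fin n, pderiv1 n lam (p ⟨(l : ℕ) + 1, h⟩ s lam) x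
            else 0)

/-- The Euler–Lagrange equation of order `2k` (`k = K+1`) of `L` for `φ`:
`Σ_{r=0}^{k} (−1)^r Σ_{μ₁…μ_r} ∂_{μ₁}⋯∂_{μ_r}[∂L/∂u_{μ₁…μ_r} ∘ (k-jet of φ)] = 0`. -/
def ELeq (n K : ℕ) (L : Jet n (K + 1) → ℝ) (φ : Vec n → ℝ) : Prop :=
  ∀ x : Vec n,
    ∑ r : Fin (K + 2),
      ((-1 : ℝ) ^ (r : ℕ)) *
        ∑ t : Fin (r : ℕ) → Fin n,
          pderivIter n (r : ℕ) t
            (fun y => dLdu n (K + 1) L r t (jetEv n (K + 1) φ y)) x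
      = 0
/-- Truncation of a jet of order `k` to a jet of order `J ≤ k`. -/
def truncJet (n J k : ℕ) (h : J ≤ k) (z : Jet n k) : Jet n J :=
  (z.1, fun r t => z.2 ⟨(r : ℕ), lt_of_lt_of_le r.isLt (Nat.succ_le_succ h)⟩ t)

/-- The total divergence of a family `F^λ` of functions of jet variables of
order `≤ J`:  the `(J+1)`-th order Lagrangian
`L₀ = Σ_λ [∂F^λ/∂x^λ + Σ_{m=0}^{J} Σ_{μ₁…μ_m} (∂F^λ/∂u_{μ₁…μ_m}) u_{μ₁…μ_m λ}]`. -/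
def totalDiv (n J : ℕ) (F : Fin n → Jet n J → ℝ) (z : Jet n (J + 1)) : ℝ :=
  ∑ lam : Fin n,
    (fderiv ℝ (F lam) (truncJet n J (J + 1) (Nat.le_succ J) z) (Pi.single lam 1, 0)
      + ∑ m : Fin (J + 1), ∑ t : Fin (m : ℕ) → Fin n,
          dLdu n J (F lam) m t (truncJet n J (J + 1) (Nat.le_succ J) z)
            * z.2 ⟨(m : ℕ) + 1, Nat.succ_lt_succ m.isLt⟩ (Fin.snoc t lam))

open scoped ContDiff

lemma IsCInf.contDiff {E G : Type*} [NormedAddCommGroup E] [NormedSpace ℝ E]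
    [NormedAddCommGroup G] [NormedSpace ℝ G] {f : E → G} (hf : IsCInf f) : ContDiff ℝ ∞ f :=
  contDiff_infty.2 hf

section PartialDerivatives

variable {n : ℕ}

lemma contDiff_pderiv1 {g : Vec n → ℝ} (hg : ContDiff ℝ ∞ g) (a : Fin n) :
    ContDiff ℝ ∞ (pderiv1 n a g) :=
  (hg.fderiv_right (m := ∞) (by simp)).clm_apply contDiff_const

lemma pderiv1_comm {g : Vec n → ℝ} (hg : ContDiff ℝ ∞ g) (a b : Fin n) :
    pderiv1 n a (pderiv1 n b g) = pderiv1 n b (pderiv1 n a g) := by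
  have hd : Differentiable ℝ (fderiv ℝ g) :=
    (hg.fderiv_right (m := ∞) (by simp)).differentiable (by simp)
  have key (a b : Fin n) (x : Vec n) : pderiv1 n a (pderiv1 n b g) x
      = fderiv ℝ (fderiv ℝ g) x (Pi.single a 1) (Pi.single b 1) := by
    unfold pderiv1
    rw [fderiv_clm_apply (hd x) (differentiableAt_const _)]
    simp
  funext x
  rw [key, key]
  exact (hg.contDiffAt.isSymmSndFDerivAt (by
    rw [minSmoothness_of_isRCLikeNormedField]; exact WithTop.coe_le_coe.2 le_top)) _ _

lemma contDiff_foldr_pderiv1 (s : List (Fin n)) {g : Vec n → ℝ} (hg : ContDiff ℝ ∞ g) :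
    ContDiff ℝ ∞ (s.foldr (pderiv1 n) g) := by
  induction s with
  | nil => exact hg
  | cons a s ih => exact contDiff_pderiv1 ih a

lemma foldr_pderiv1_perm {s s' : List (Fin n)} (h : s.Perm s') {g : Vec n → ℝ}
    (hg : ContDiff ℝ ∞ g) : s.foldr (pderiv1 n) g = s'.foldr (pderiv1 n) g := by
  induction h with
  | nil => rfl
  | cons a _ ih => simp only [List.foldr_cons, ih]
  | swap a b s => exact pderiv1_comm (contDiff_foldr_pderiv1 s hg) _ _
  | trans _ _ ih₁ ih₂ => exact ih₁.trans ih₂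

lemma pderivIter_eq_foldr {g : Vec n → ℝ} (hg : ContDiff ℝ ∞ g) {r : ℕ} (t : Fin r → Fin n) :
    pderivIter n r t g = (List.ofFn t).foldr (pderiv1 n) g := by
  induction r with
  | zero => funext x; simp [pderivIter]
  | succ r ih =>
    rw [List.ofFn_succ, List.foldr_cons, ← ih]
    funext x
    refine DifferentiableAt.iteratedFDeriv_succ_apply_left' ?_
    exact (hg.differentiable_iteratedFDeriv (m := r) (WithTop.coe_lt_coe.2 (ENat.natCast_lt_top r))) x

lemma contDiff_pderivIter {g : Vec n → ℝ} (hg : ContDiff ℝ ∞ g) {r : ℕ} (t : Fin r → Fin n) :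
    ContDiff ℝ ∞ (pderivIter n r t g) := by
  rw [pderivIter_eq_foldr hg]
  exact contDiff_foldr_pderiv1 _ hg

lemma pderivIter_comp_perm {g : Vec n → ℝ} (hg : ContDiff ℝ ∞ g) {r : ℕ} (t : Fin r → Fin n)
    (σ : Equiv.Perm (Fin r)) : pderivIter n r (t ∘ σ) g = pderivIter n r t g := by
  rw [pderivIter_eq_foldr hg, pderivIter_eq_foldr hg]
  exact foldr_pderiv1_perm (σ.ofFn_comp_perm t) hg

lemma pderivIter_snoc {g : Vec n → ℝ} (hg : ContDiff ℝ ∞ g) {r : ℕ} (t : Fin r → Fin n)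
    (a : Fin n) : pderivIter n (r + 1) (Fin.snoc t a) g = pderivIter n r t (pderiv1 n a g) := by
  rw [pderivIter_eq_foldr hg, pderivIter_eq_foldr (contDiff_pderiv1 hg a), List.ofFn_succ']
  simp

lemma pderiv1_pderivIter {g : Vec n → ℝ} (hg : ContDiff ℝ ∞ g) {r : ℕ} (t : Fin r → Fin n)
    (a : Fin n) : pderiv1 n a (pderivIter n r t g) = pderivIter n (r + 1) (Fin.snoc t a) g := by
  rw [pderivIter_eq_foldr hg, pderivIter_eq_foldr hg, ← List.foldr_cons (f := pderiv1 n)]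
  refine foldr_pderiv1_perm ?_ hg
  rw [List.ofFn_succ']
  simpa using (List.perm_append_singleton a (List.ofFn t)).symm

lemma pderivIter_sum {ι : Type*} (u : Finset ι) {g : ι → Vec n → ℝ}
    (hg : ∀ i ∈ u, ContDiff ℝ ∞ (g i)) {r : ℕ} (t : Fin r → Fin n) (x : Vec n) :
    pderivIter n r t (fun y => ∑ i ∈ u, g i y) x = ∑ i ∈ u, pderivIter n r t (g i) x := by
  unfold pderivIter
  rw [iteratedFDeriv_fun_sum_apply fun i hi => (contDiff_infty.1 (hg i hi) r).contDiffAt]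
  simp

lemma pderivIter_add {f g : Vec n → ℝ} (hf : ContDiff ℝ ∞ f) (hg : ContDiff ℝ ∞ g) {r : ℕ}
    (t : Fin r → Fin n) (x : Vec n) :
    pderivIter n r t (fun y => f y + g y) x = pderivIter n r t f x + pderivIter n r t g x := by
  simpa using pderivIter_sum Finset.univ (g := fun b : Bool => if b then f else g)
    (by rintro (_ | _) _ <;> simpa) t x

lemma pderivIter_const_mul (c : ℝ) {g : Vec n → ℝ} (hg : ContDiff ℝ ∞ g) {r : ℕ}
    (t : Fin r → Fin n) (x : Vec n) :
    pderivIter n r t (fun y => c * g y) x = c * pderivIter n r t g x := by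
  unfold pderivIter
  have := iteratedFDeriv_const_smul_apply' (a := c) (contDiff_infty.1 hg r).contDiffAt (x := x)
  simp only [smul_eq_mul] at this
  rw [this]
  simp

lemma pderivIter_zero {r : ℕ} (t : Fin r → Fin n) (x : Vec n) :
    pderivIter n r t (fun _ => 0) x = 0 := by
  simpa using pderivIter_sum (∅ : Finset ℕ) (g := fun _ _ => 0) (by simp) t x

/-- Contracting an array with the (symmetric) iterated partial derivatives does not see whether
the array has been symmetrized. -/
lemma sum_pderivIter_symm {r : ℕ} {h : (Fin r → Fin n) → Vec n → ℝ}
    (hh : ∀ t, ContDiff ℝ ∞ (h t)) (x : Vec n) :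
    ∑ t, pderivIter n r t (fun y => (r.factorial : ℝ)⁻¹ * ∑ σ : Equiv.Perm (Fin r), h (t ∘ σ) y) x
      = ∑ t, pderivIter n r t (h t) x := by
  have hperm (σ : Equiv.Perm (Fin r)) :
      ∑ t, pderivIter n r t (h (t ∘ σ)) x = ∑ t, pderivIter n r t (h t) x := by
    rw [← (Equiv.arrowCongr σ.symm (Equiv.refl (Fin n))).sum_comp
      (fun t => pderivIter n r t (h t) x)]
    refine Finset.sum_congr rfl fun t _ => ?_
    rw [← pderivIter_comp_perm (hh _) t σ]
    rfl
  calc _ = (r.factorial : ℝ)⁻¹ * ∑ t, ∑ σ : Equiv.Perm (Fin r), pderivIter n r t (h (t ∘ σ)) x := by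
        rw [Finset.mul_sum]
        refine Finset.sum_congr rfl fun t _ => ?_
        rw [pderivIter_const_mul _ (ContDiff.sum fun σ _ => hh _),
          pderivIter_sum _ fun σ _ => hh _]
    _ = _ := by
        rw [Finset.sum_comm, Finset.sum_congr rfl fun σ _ => hperm σ]
        simp [Fintype.card_perm, Nat.factorial_ne_zero]

end PartialDerivatives

/-- Derivative of the differential of `f` evaluated at a linear base point and on an affine direction. -/
lemma hasFDerivAt_fderiv_comp_apply {E G : Type*} [NormedAddCommGroup E] [NormedSpace ℝ E]
    [NormedAddCommGroup G] [NormedSpace ℝ G] {f : G → ℝ} (hf : ContDiff ℝ ∞ f)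
    (T S : E →L[ℝ] G) (c : G) (z : E) :
    HasFDerivAt (fun z => fderiv ℝ f (T z) (c + S z))
      (((fderiv ℝ (fderiv ℝ f) (T z)).comp T).flip (c + S z) + (fderiv ℝ f (T z)).comp S) z := by
  have hd : HasFDerivAt (fderiv ℝ f) (fderiv ℝ (fderiv ℝ f) (T z)) (T z) :=
    ((hf.fderiv_right (m := ∞) (by simp)).differentiable (by simp) _).hasFDerivAt
  rw [add_comm]
  exact (hd.comp z T.hasFDerivAt).clm_apply (S.hasFDerivAt.const_add c)

section JetSpace

variable {n k J : ℕ}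

/-- The coordinate direction of the jet variable `u_{t}` of rank `r`. -/
def jetBasis (n k : ℕ) (r : Fin (k + 1)) (t : Fin (r : ℕ) → Fin n) : Jet n k :=
  (0, Pi.single r (Pi.single t 1))

/-- The symmetrization of `jetBasis` over the indices of the tuple. -/
def symJetBasis (n k : ℕ) (r : Fin (k + 1)) (t : Fin (r : ℕ) → Fin n) : Jet n k :=
  ((r : ℕ).factorial : ℝ)⁻¹ • ∑ σ : Equiv.Perm (Fin (r : ℕ)), jetBasis n k r (t ∘ σ)

/-- The coordinate `u_{t}` of rank `r` as a continuous linear functional. -/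
def jetCoord (n k : ℕ) (r : Fin (k + 1)) (t : Fin (r : ℕ) → Fin n) : Jet n k →L[ℝ] ℝ :=
  LinearMap.toContinuousLinearMap
    { toFun := fun z => z.2 r t, map_add' := fun _ _ => rfl, map_smul' := fun _ _ => rfl }

/-- Truncation of jets as a continuous linear map. -/
def truncJetL (n J : ℕ) : Jet n (J + 1) →L[ℝ] Jet n J :=
  LinearMap.toContinuousLinearMap
    { toFun := truncJet n J (J + 1) (Nat.le_succ J)
      map_add' := fun _ _ => rfl
      map_smul' := fun _ _ => rfl }

/-- The linear part of the total derivative in direction `lam`: the map sending the jet variables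
`u` to the symmetrization of `u_{μ₁…μ_m lam}`. -/
def jetShift (n J : ℕ) (lam : Fin n) : Jet n (J + 1) →L[ℝ] Jet n J :=
  ∑ m : Fin (J + 1), ∑ t : Fin (m : ℕ) → Fin n,
    (jetCoord n (J + 1) m.succ (Fin.snoc t lam : Fin ((m : ℕ) + 1) → Fin n)).smulRight
      (symJetBasis n J m t)

lemma dLdu_eq_fderiv (L : Jet n k → ℝ) (r : Fin (k + 1)) (t : Fin (r : ℕ) → Fin n) (z : Jet n k) :
    dLdu n k L r t z = fderiv ℝ L z (symJetBasis n k r t) := by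
  simp [dLdu, symJetBasis, jetBasis]

lemma jetShift_apply (lam : Fin n) (z : Jet n (J + 1)) :
    jetShift n J lam z = ∑ m : Fin (J + 1), ∑ t : Fin (m : ℕ) → Fin n,
      z.2 m.succ (Fin.snoc t lam : Fin ((m : ℕ) + 1) → Fin n) • symJetBasis n J m t := by
  simp [jetShift, jetCoord]

lemma totalDiv_eq (F : Fin n → Jet n J → ℝ) (z : Jet n (J + 1)) :
    totalDiv n J F z = ∑ lam, fderiv ℝ (F lam) (truncJetL n J z)
      ((Pi.single lam 1, 0) + jetShift n J lam z) := by
  refine Finset.sum_congr rfl fun lam _ => ?_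
  rw [map_add, jetShift_apply, map_sum]
  simp only [map_sum, map_smul, dLdu_eq_fderiv, smul_eq_mul, mul_comm]
  rfl

lemma fderiv_totalDiv {F : Fin n → Jet n J → ℝ} (hF : ∀ lam, ContDiff ℝ ∞ (F lam))
    (z w : Jet n (J + 1)) :
    fderiv ℝ (totalDiv n J F) z w = ∑ lam,
      (fderiv ℝ (fderiv ℝ (F lam)) (truncJetL n J z) (truncJetL n J w)
          ((Pi.single lam 1, 0) + jetShift n J lam z)
        + fderiv ℝ (F lam) (truncJetL n J z) (jetShift n J lam w)) := by
  rw [funext (totalDiv_eq F), fderiv_fun_sum fun lam _ =>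
    (hasFDerivAt_fderiv_comp_apply (hF lam) _ _ _ z).differentiableAt, sum_apply]
  refine Finset.sum_congr rfl fun lam _ => ?_
  rw [(hasFDerivAt_fderiv_comp_apply (hF lam) _ _ _ z).fderiv]
  rfl

lemma truncJetL_jetBasis_last (t : Fin (J + 1) → Fin n) :
    truncJetL n J (jetBasis n (J + 1) (Fin.last (J + 1)) t) = 0 := by
  refine Prod.ext rfl ?_
  funext r s
  change (Pi.single (M := fun r : Fin (J + 2) => (Fin (r : ℕ) → Fin n) → ℝ)
    (Fin.last (J + 1)) (Pi.single t 1)) r.castSucc s = 0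
  rw [Pi.single_eq_of_ne (Fin.castSucc_lt_last r).ne]
  rfl

lemma truncJetL_jetBasis_castSucc (r : Fin (J + 1)) (t : Fin (r : ℕ) → Fin n) :
    truncJetL n J (jetBasis n (J + 1) r.castSucc t) = jetBasis n J r t := by
  refine Prod.ext rfl ?_
  funext r' s
  change (Pi.single (M := fun r : Fin (J + 2) => (Fin (r : ℕ) → Fin n) → ℝ)
    r.castSucc (Pi.single t 1)) r'.castSucc s =
    (Pi.single (M := fun r : Fin (J + 1) => (Fin (r : ℕ) → Fin n) → ℝ) r (Pi.single t 1)) r' s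
  by_cases h : r' = r
  · subst h
    rw [Pi.single_eq_same, Pi.single_eq_same]
  · rw [Pi.single_eq_of_ne h, Pi.single_eq_of_ne (fun h' => h (Fin.castSucc_injective _ h'))]

lemma jetShift_jetBasis_zero (lam : Fin n) (t : Fin 0 → Fin n) :
    jetShift n J lam (jetBasis n (J + 1) 0 t) = 0 := by
  rw [jetShift_apply]
  refine Finset.sum_eq_zero fun m _ => Finset.sum_eq_zero fun s _ => ?_
  simp only [jetBasis]
  rw [Pi.single_eq_of_ne (Fin.succ_ne_zero m)]
  simp

lemma jetShift_jetBasis_succ (lam mu : Fin n) (r : Fin (J + 1)) (t : Fin (r : ℕ) → Fin n) :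
    jetShift n J lam (jetBasis n (J + 1) r.succ (Fin.snoc t mu : Fin ((r : ℕ) + 1) → Fin n))
      = if mu = lam then symJetBasis n J r t else 0 := by
  rw [jetShift_apply, Finset.sum_eq_single r]
  · simp only [jetBasis, Pi.single_eq_same]
    rw [Finset.sum_eq_single t]
    · by_cases h : mu = lam
      · subst h
        rw [Pi.single_eq_same, if_pos rfl, one_smul]
      · rw [Pi.single_eq_of_ne (fun h' => h ?_), if_neg h, zero_smul]
        have := congrFun h' (Fin.last (r : ℕ))
        simpa using this.symm
    · intro s _ hs
      rw [Pi.single_eq_of_ne (fun h' => hs ?_), zero_smul]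
      have := congrArg (Fin.init (α := fun _ => Fin n)) h'
      simpa using this
    · simp
  · intro m _ hm
    refine Finset.sum_eq_zero fun s _ => ?_
    simp only [jetBasis]
    rw [Pi.single_eq_of_ne (fun h' => hm (Fin.succ_injective _ h'))]
    simp
  · simp

lemma sum_smul_jetBasis (v : JetU n k) :
    ∑ r, ∑ t, v r t • jetBasis n k r t = (0, v) := by
  refine Prod.ext ?_ ?_
  · simp [Prod.fst_sum, jetBasis]
  · simp only [Prod.snd_sum, jetBasis, Prod.smul_snd]
    funext r s
    rw [Finset.sum_apply, Finset.sum_apply, Finset.sum_eq_single r]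
    · simp [Finset.sum_apply, Pi.single_apply]
    · intro r' _ h
      simp [Finset.sum_apply, Pi.single_eq_of_ne h.symm]
    · simp

/-- Contraction of a symmetric array with the symmetrized directions. -/
lemma sum_smul_symJetBasis (r : Fin (k + 1)) (c : (Fin (r : ℕ) → Fin n) → ℝ)
    (hc : ∀ (σ : Equiv.Perm (Fin (r : ℕ))) t, c (t ∘ σ) = c t) :
    ∑ t, c t • symJetBasis n k r t = ∑ t, c t • jetBasis n k r t := by
  have hperm (σ : Equiv.Perm (Fin (r : ℕ))) :
      ∑ t, c t • jetBasis n k r (t ∘ σ) = ∑ t, c t • jetBasis n k r t := by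
    rw [← (Equiv.arrowCongr σ.symm (Equiv.refl (Fin n))).sum_comp
      (fun t => c t • jetBasis n k r t)]
    refine Finset.sum_congr rfl fun t _ => ?_
    rw [← hc σ t]
    rfl
  calc _ = ((r : ℕ).factorial : ℝ)⁻¹ • ∑ t, ∑ σ : Equiv.Perm (Fin (r : ℕ)),
          c t • jetBasis n k r (t ∘ σ) := by
        simp only [symJetBasis, Finset.smul_sum, smul_comm (c _)]
    _ = _ := by
        rw [Finset.sum_comm, Finset.sum_congr rfl fun σ _ => hperm σ, Finset.sum_const,
          Finset.card_univ, Fintype.card_perm, Fintype.card_fin, ← Nat.cast_smul_eq_nsmul ℝ,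
          smul_smul, inv_mul_cancel₀ (by exact_mod_cast Nat.factorial_ne_zero _), one_smul]

end JetSpace

section JetProlongation

variable {n J : ℕ} {φ : Vec n → ℝ}

lemma contDiff_jetEv (hφ : ContDiff ℝ ∞ φ) (k : ℕ) : ContDiff ℝ ∞ (jetEv n k φ) :=
  contDiff_id.prodMk (contDiff_pi.2 fun _ => contDiff_pi.2 fun t => contDiff_pderivIter hφ t)

/-- The partial derivatives of the jet prolongation are given by the total derivatives. -/
lemma fderiv_jetEv (hφ : ContDiff ℝ ∞ φ) (lam : Fin n) (y : Vec n) :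
    fderiv ℝ (jetEv n J φ) y (Pi.single lam 1)
      = (Pi.single lam 1, 0) + jetShift n J lam (jetEv n (J + 1) φ y) := by
  have hs : jetShift n J lam (jetEv n (J + 1) φ y)
      = ((0, fun r t => pderiv1 n lam (pderivIter n (r : ℕ) t φ) y) : Jet n J) := by
    rw [jetShift_apply, ← sum_smul_jetBasis]
    refine Finset.sum_congr rfl fun m _ => ?_
    have hsnoc (t : Fin (m : ℕ) → Fin n) : (jetEv n (J + 1) φ y).2 m.succ
        (Fin.snoc t lam : Fin ((m : ℕ) + 1) → Fin n) = pderiv1 n lam (pderivIter n m t φ) y := by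
      rw [pderiv1_pderivIter hφ]
      rfl
    simp only [hsnoc]
    refine sum_smul_symJetBasis m (fun t => pderiv1 n lam (pderivIter n m t φ) y) fun σ t => ?_
    rw [pderivIter_comp_perm hφ]
  have hd (r : Fin (J + 1)) (t : Fin (r : ℕ) → Fin n) :
      HasFDerivAt (pderivIter n (r : ℕ) t φ) (fderiv ℝ (pderivIter n (r : ℕ) t φ) y) y :=
    ((contDiff_pderivIter hφ t).differentiable (by simp) y).hasFDerivAt
  have h : HasFDerivAt (jetEv n J φ) _ y :=
    (hasFDerivAt_id y).prodMk (hasFDerivAt_pi.2 fun r => hasFDerivAt_pi.2 fun t => hd r t)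
  rw [h.fderiv, hs]
  refine Prod.ext ?_ ?_
  · simp
  · simp
    rfl

/-- The derivative of a total divergence along the jet of `φ`. -/
lemma fderiv_totalDiv_jetEv {F : Fin n → Jet n J → ℝ} (hF : ∀ lam, ContDiff ℝ ∞ (F lam))
    (hφ : ContDiff ℝ ∞ φ) (w : Jet n (J + 1)) (y : Vec n) :
    fderiv ℝ (totalDiv n J F) (jetEv n (J + 1) φ y) w = ∑ lam,
      (pderiv1 n lam (fun y => fderiv ℝ (F lam) (jetEv n J φ y) (truncJetL n J w)) y
        + fderiv ℝ (F lam) (jetEv n J φ y) (jetShift n J lam w)) := by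
  rw [fderiv_totalDiv hF]
  refine Finset.sum_congr rfl fun lam _ => ?_
  congr 1
  have hd : DifferentiableAt ℝ (fderiv ℝ (F lam)) (jetEv n J φ y) :=
    ((hF lam).fderiv_right (m := ∞) (by simp)).differentiable (by simp) _
  have hj : DifferentiableAt ℝ (jetEv n J φ) y := (contDiff_jetEv hφ J).differentiable (by simp) y
  have hsymm : IsSymmSndFDerivAt ℝ (F lam) (jetEv n J φ y) :=
    (hF lam).contDiffAt.isSymmSndFDerivAt (by
      rw [minSmoothness_of_isRCLikeNormedField]; exact WithTop.coe_le_coe.2 le_top)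
  have h := (hd.hasFDerivAt.comp y hj.hasFDerivAt).clm_apply
    (hasFDerivAt_const (truncJetL n J w) y)
  rw [← fderiv_jetEv hφ, pderiv1]
  refine Eq.trans ?_ (congrArg (fun A => A (Pi.single lam 1)) h.fderiv).symm
  simp only [ContinuousLinearMap.comp_zero, zero_add, ContinuousLinearMap.flip_apply,
    ContinuousLinearMap.comp_apply]
  exact hsymm _ _

end JetProlongation

/-- the higher-order Euler–Lagrange operator annihilates total
divergences.  Let `L₀` be the total divergence of smooth functions `F^λ` of
jet variables of order `≤ l−1` (here `l = J+1 ≥ 1`).  Then every smooth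
`φ : ℝⁿ → ℝ` satisfies identically the Euler–Lagrange equation of order `2l`
of `L₀`: the dynamics generated by a total-divergence Lagrangian is trivial. -/
theorem statement_9 (n J : ℕ) (hn : 1 ≤ n)
    (F : Fin n → Jet n J → ℝ) (hF : ∀ lam, IsCInf (F lam))
    (φ : Vec n → ℝ) (hφ : IsCInf φ) :
    ELeq n J (totalDiv n J F) φ := by
  intro x
  have hφ' := hφ.contDiff
  have hF' lam := (hF lam).contDiff
  have hG (lam : Fin n) (w : Jet n J) :
      ContDiff ℝ ∞ fun y => fderiv ℝ (F lam) (jetEv n J φ y) w :=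
    (((hF' lam).fderiv_right (m := ∞) (by simp)).comp (contDiff_jetEv hφ' J)).clm_apply
      contDiff_const
  have hD (w : Jet n (J + 1)) :
      (fun y => fderiv ℝ (totalDiv n J F) (jetEv n (J + 1) φ y) w) = fun y =>
        (∑ lam, pderiv1 n lam (fun y => fderiv ℝ (F lam) (jetEv n J φ y) (truncJetL n J w)) y)
          + ∑ lam, fderiv ℝ (F lam) (jetEv n J φ y) (jetShift n J lam w) := by
    funext y
    rw [fderiv_totalDiv_jetEv hF' hφ', Finset.sum_add_distrib]
  have hDc (w : Jet n (J + 1)) :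
      ContDiff ℝ ∞ fun y => fderiv ℝ (totalDiv n J F) (jetEv n (J + 1) φ y) w := by
    rw [hD]
    exact (ContDiff.sum fun lam _ => contDiff_pderiv1 (hG lam _) lam).add
      (ContDiff.sum fun lam _ => hG lam _)
  have hsplit (r : Fin (J + 2)) :
      ∑ t : Fin (r : ℕ) → Fin n, pderivIter n (r : ℕ) t
          (fun y => dLdu n (J + 1) (totalDiv n J F) r t (jetEv n (J + 1) φ y)) x
        = (∑ t : Fin (r : ℕ) → Fin n, ∑ lam, pderivIter n (r : ℕ) t (pderiv1 n lam fun y =>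
            fderiv ℝ (F lam) (jetEv n J φ y) (truncJetL n J (jetBasis n (J + 1) r t))) x)
          + ∑ t : Fin (r : ℕ) → Fin n, ∑ lam, pderivIter n (r : ℕ) t (fun y =>
            fderiv ℝ (F lam) (jetEv n J φ y) (jetShift n J lam (jetBasis n (J + 1) r t))) x := by
    rw [← Finset.sum_add_distrib]
    refine (sum_pderivIter_symm (fun t => hDc (jetBasis n (J + 1) r t)) x).trans ?_
    refine Finset.sum_congr rfl fun t _ => ?_
    rw [hD, pderivIter_add (ContDiff.sum fun lam _ => contDiff_pderiv1 (hG lam _) lam)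
      (ContDiff.sum fun lam _ => hG lam _),
      pderivIter_sum _ fun lam _ => contDiff_pderiv1 (hG lam _) lam,
      pderivIter_sum _ fun lam _ => hG lam _]
  have hshift (r : Fin (J + 1)) :
      ∑ s : Fin ((r : ℕ) + 1) → Fin n, ∑ lam, pderivIter n ((r : ℕ) + 1) s (fun y =>
          fderiv ℝ (F lam) (jetEv n J φ y) (jetShift n J lam (jetBasis n (J + 1) r.succ s))) x
        = ∑ t : Fin (r : ℕ) → Fin n, ∑ lam, pderivIter n (r : ℕ) t (pderiv1 n lam fun y =>
            fderiv ℝ (F lam) (jetEv n J φ y) (jetBasis n J r t)) x := by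
    rw [← (Fin.snocEquiv fun _ => Fin n).sum_comp, Fintype.sum_prod_type, Finset.sum_comm]
    have hterm (mu : Fin n) (t : Fin (r : ℕ) → Fin n) (lam : Fin n) :
        pderivIter n ((r : ℕ) + 1) (Fin.snocEquiv (fun _ => Fin n) (mu, t)) (fun y =>
          fderiv ℝ (F lam) (jetEv n J φ y) (jetShift n J lam (jetBasis n (J + 1) r.succ
            (Fin.snocEquiv (fun _ => Fin n) (mu, t))))) x
        = if mu = lam then pderivIter n ((r : ℕ) + 1) (Fin.snoc t lam) (fun y =>
            fderiv ℝ (F lam) (jetEv n J φ y) (symJetBasis n J r t)) x else 0 := by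
      change pderivIter n ((r : ℕ) + 1) (Fin.snoc t mu) (fun y =>
          fderiv ℝ (F lam) (jetEv n J φ y) (jetShift n J lam (jetBasis n (J + 1) r.succ
            (Fin.snoc t mu : Fin ((r : ℕ) + 1) → Fin n)))) x = _
      rw [jetShift_jetBasis_succ]
      split_ifs with h
      · rw [h]
      · simp only [map_zero]
        exact pderivIter_zero _ x
    simp only [hterm, Finset.sum_ite_eq, Finset.mem_univ, if_true]
    rw [Finset.sum_comm]
    conv_rhs => rw [Finset.sum_comm]
    refine Finset.sum_congr rfl fun lam _ => ?_
    rw [← sum_pderivIter_symm fun t => contDiff_pderiv1 (hG lam (jetBasis n J r t)) lam]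
    refine Finset.sum_congr rfl fun t _ => ?_
    rw [pderivIter_snoc (hG lam _)]
    congr 1
    funext y
    have hd w := (hG lam w).differentiable (by simp) y
    simp only [pderiv1, symJetBasis, map_smul, map_sum, smul_eq_mul]
    rw [fderiv_const_mul (DifferentiableAt.fun_sum fun σ _ => hd _),
      fderiv_fun_sum fun σ _ => hd _]
    simp
  rw [Finset.sum_congr rfl fun r _ => by rw [hsplit r, mul_add], Finset.sum_add_distrib,
    Fin.sum_univ_castSucc, Fin.sum_univ_succ (n := J + 1)]
  have hlast (t : Fin (J + 1) → Fin n) (lam : Fin n) :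
      pderivIter n (J + 1) t (pderiv1 n lam fun y => fderiv ℝ (F lam) (jetEv n J φ y)
        (truncJetL n J (jetBasis n (J + 1) (Fin.last (J + 1)) t))) x = 0 := by
    rw [truncJetL_jetBasis_last]
    have h0 : (pderiv1 n lam fun y => fderiv ℝ (F lam) (jetEv n J φ y) 0) = fun _ => 0 := by
      funext y
      simp [pderiv1]
    rw [h0, pderivIter_zero]
  have hzero (t : Fin 0 → Fin n) (lam : Fin n) :
      pderivIter n 0 t (fun y => fderiv ℝ (F lam) (jetEv n J φ y)
        (jetShift n J lam (jetBasis n (J + 1) 0 t))) x = 0 := by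
    rw [jetShift_jetBasis_zero]
    simp only [map_zero]
    exact pderivIter_zero _ x
  have hlast' := Finset.sum_eq_zero fun t (_ : t ∈ Finset.univ) =>
    Finset.sum_eq_zero fun lam (_ : lam ∈ Finset.univ) => hlast t lam
  have hzero' := Finset.sum_eq_zero fun t (_ : t ∈ Finset.univ) =>
    Finset.sum_eq_zero fun lam (_ : lam ∈ Finset.univ) => hzero t lam
  refine (congrArg₂ (· + ·) (congrArg₂ (· + ·) rfl (congrArg (_ * ·) hlast'))
    (congrArg₂ (· + ·) (congrArg (_ * ·) hzero') (Finset.sum_congr rfl fun r _ =>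
      congrArg (_ * ·) (hshift r)))).trans ?_
  simp only [truncJetL_jetBasis_castSucc, Fin.val_castSucc, Fin.val_succ, pow_succ]
  simp
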